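/- arXiv:2401.00628 — 2 statements merged into one kernel-verified Lean document; each statement's English description precedes it below -/
import Mathlib

section
/- Let d ≥ 1 and let π ∈ S_d have cycle type α = (α_1,…,α_k) (a partition of d with k = ℓ(π) parts, including parts equal to 1). Then the number of factorizations of π into the minimal number r = d − k of transpositions equals the multinomial coefficient (d−k choose α_1−1, …, α_k−1) times the product over i = 1,…,k of Cay_{α_i−1}, where Cay_n = (n+1)^{n−1} is the Cayley number. -/
noncomputable section

/-- The number of cycles of a permutation of `{1,…,d}`, counting fixed points as 1-cycles. -/
def ell {d : ℕ} (π : Equiv.Perm (Fin d)) : ℕ :=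
  π.cycleType.card + (d - π.support.card)

/-- The cycle type of a permutation of `{1,…,d}` including parts equal to `1` for fixed points. -/
def fullCycleType {d : ℕ} (π : Equiv.Perm (Fin d)) : Multiset ℕ :=
  π.cycleType + Multiset.replicate (d - π.support.card) 1

/-- The Cayley number `Cay_n = (n+1)^(n-1)` (with `Cay_0 = 1`). -/
def cay (n : ℕ) : ℕ := (n + 1) ^ (n - 1)

/-- The number of factorizations of `π` into `r` transpositions, i.e. sequences
`(τ_1, …, τ_r)` of transpositions with `τ_1 ⋯ τ_r = π`. -/
def swapFactorizationCount (d r : ℕ) (π : Equiv.Perm (Fin d)) : ℕ :=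
  Nat.card {l : List (Equiv.Perm (Fin d)) //
    l.length = r ∧ (∀ τ ∈ l, τ.IsSwap) ∧ l.prod = π}

open Polynomial in
/-- A form of Abel's binomial theorem. -/
theorem abel_sum (m : ℕ) :
    ∑ k ∈ Finset.range (m + 1), C (((m + 1).choose (k + 1) : ℚ) * (k + 1) ^ k) *
      (X + C ((m : ℚ) - k)) ^ (m - k) = C ((m : ℚ) + 1) * (X + C ((m : ℚ) + 1)) ^ m := by
  induction m with
  | zero => simp
  | succ m ih =>
    rw [← sub_eq_zero]
    set D : ℚ[X] := _ - _ with hD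
    have hder : derivative D = 0 := by
      have ih' := congrArg (fun p => C ((m : ℚ) + 2) * (X + 1 : ℚ[X]).compRingHom p) ih
      rw [hD, derivative_sub, sub_eq_zero, derivative_sum, Finset.sum_range_succ]
      simp only [map_sum, coe_compRingHom_apply, mul_comp, pow_comp, add_comp, X_comp, C_comp,
        Finset.mul_sum] at ih'
      trans (∑ i ∈ Finset.range (m + 1), C ((m : ℚ) + 2) *
        (C (((m + 1).choose (i + 1) : ℚ) * (i + 1) ^ i) * (X + 1 + C ((m : ℚ) - i)) ^ (m - i)))
      · rw [Nat.sub_self, pow_zero, mul_one, derivative_C, add_zero]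
        refine Finset.sum_congr rfl fun i hi => ?_
        have hi' : i ≤ m := by simpa [Nat.lt_succ_iff] using hi
        have hc : ((m + 1 + 1).choose (i + 1) : ℚ) * ((m : ℚ) + 1 - i) =
            (m + 2) * (m + 1).choose (i + 1) := by
          have h := Nat.choose_mul_succ_eq (m + 1) (i + 1)
          rw [show m + 1 + 1 - (i + 1) = m + 1 - i by omega] at h
          have h2 : (((m + 1 - i : ℕ)) : ℚ) = m + 1 - i := by
            rw [Nat.cast_sub (by omega)]; push_cast; ring
          rw [← h2]
          have := congrArg (Nat.cast : ℕ → ℚ) h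
          push_cast at this ⊢
          linarith
        have hs : m + 1 - i = (m - i) + 1 := by omega
        have hx : X + C (((m + 1 : ℕ) : ℚ) - i) = X + 1 + C ((m : ℚ) - i) := by
          rw [add_assoc, ← C_1, ← C_add]; congr 2; push_cast; ring
        have h2 : (((m - i : ℕ)) : ℚ) + 1 = m + 1 - i := by
          rw [Nat.cast_sub (by omega)]; ring
        rw [hx, hs, derivative_C_mul, derivative_pow_succ]
        simp only [derivative_add, derivative_X, derivative_one, derivative_C, add_zero, mul_one]
        rw [h2, ← mul_assoc, ← mul_assoc, ← C_mul, ← C_mul]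
        congr 2
        linear_combination ((i : ℚ) + 1) ^ i * hc
      · rw [ih']
        have hx : X + C (((m + 1 : ℕ) : ℚ) + 1) = X + 1 + C ((m : ℚ) + 1) := by
          rw [add_assoc, ← C_1, ← C_add]; congr 2; push_cast; ring
        rw [hx, derivative_C_mul, derivative_pow_succ]
        simp only [derivative_add, derivative_X, derivative_one, derivative_C, add_zero, mul_one]
        push_cast
        simp only [map_add, map_natCast, map_ofNat, map_one]
        ring
    have heval : D.eval (-((m : ℚ) + 2)) = 0 := by
      have h := congrFun (fwdDiff_iter_pow_eq_zero_of_lt (R := ℚ) (Nat.lt_succ_self (m + 1))) 0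
      rw [fwdDiff_iter_eq_sum_shift, Finset.sum_range_succ'] at h
      simp only [hD, eval_sub, eval_finsetSum, eval_mul, eval_C, eval_pow, eval_add, eval_X]
      push_cast
      rw [show -((m : ℚ) + 2) + (m + 1 + 1) = 0 by ring, zero_pow (by omega), mul_zero, sub_zero]
      simp only [zero_add, Pi.zero_apply] at h
      rw [← h]
      simp only [zero_smul, ne_eq, Nat.succ_ne_zero, not_false_eq_true, zero_pow, smul_zero,
        add_zero]
      refine Finset.sum_congr rfl fun i hi => ?_
      have hi' : i ≤ m + 1 := by simpa [Nat.lt_succ_iff] using hi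
      rw [show m + 1 + 1 - (i + 1) = m + 1 - i by omega,
        show -((m : ℚ) + 2) + (m + 1 - i) = (-1) * (i + 1) by ring, mul_pow]
      obtain ⟨j, hj⟩ := Nat.exists_eq_add_of_le hi'
      rw [show m + 1 - i = j by omega, hj]
      simp only [zsmul_eq_mul, nsmul_eq_mul]
      push_cast
      ring
    rw [eq_C_of_derivative_eq_zero hder] at heval ⊢
    simpa using heval

/-- The weight `n ^ (n - 2) / (n - 1)!` that an `n`-cycle contributes to the number of minimal
factorizations. -/
noncomputable def cycleWeight (n : ℕ) : ℚ := (n ^ (n - 2) : ℕ) / (n - 1).factorial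

theorem sum_cycleWeight_mul (n : ℕ) (hn : 2 ≤ n) :
    n * ∑ j ∈ Finset.Ico 1 n, cycleWeight j * cycleWeight (n - j) =
      2 * (n - 1) * cycleWeight n := by
  obtain ⟨m, rfl⟩ : ∃ m, n = m + 2 := ⟨n - 2, by omega⟩
  have h := congrArg (Polynomial.eval 0) (abel_sum (m + 1))
  simp only [Polynomial.eval_finsetSum, Polynomial.eval_mul, Polynomial.eval_C,
    Polynomial.eval_pow, Polynomial.eval_add, Polynomial.eval_X, zero_add] at h
  have hw : ∀ j, 1 ≤ j → cycleWeight j = (j : ℚ) ^ j / (j * j.factorial) := by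
    intro j hj
    obtain rfl | hj := hj.eq_or_lt
    · simp [cycleWeight]
    obtain ⟨i, rfl⟩ : ∃ i, j = i + 2 := ⟨j - 2, by omega⟩
    simp only [cycleWeight, Nat.add_sub_cancel, show i + 2 - 1 = i + 1 by omega]
    rw [Nat.factorial_succ (i + 1)]
    have := Nat.factorial_ne_zero (i + 1)
    push_cast
    field_simp
    ring
  set S := ∑ j ∈ Finset.Ico 1 (m + 2), cycleWeight j * cycleWeight (m + 2 - j) with hS
  have hT : ∑ j ∈ Finset.Ico 1 (m + 2), j * (cycleWeight j * cycleWeight (m + 2 - j)) =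
      ∑ j ∈ Finset.Ico 1 (m + 2),
        ((m + 2 : ℕ) - j : ℚ) * (cycleWeight j * cycleWeight (m + 2 - j)) := by
    refine Finset.sum_nbij' (fun j => m + 2 - j) (fun j => m + 2 - j) ?_ ?_ ?_ ?_ ?_ <;>
      simp only [Finset.mem_Ico] <;> intro j hj
    iterate 4 omega
    rw [show m + 2 - (m + 2 - j) = j by omega, Nat.cast_sub (by omega)]
    ring
  have hST : ((m + 2 : ℕ) : ℚ) * S = 2 * ∑ j ∈ Finset.Ico 1 (m + 2),
      ((m + 2 : ℕ) - j : ℚ) * (cycleWeight j * cycleWeight (m + 2 - j)) := by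
    rw [two_mul]
    nth_rw 1 [← hT]
    rw [← Finset.sum_add_distrib, hS, Finset.mul_sum]
    refine Finset.sum_congr rfl fun j _ => by ring
  rw [hST]
  rw [Finset.sum_range_succ] at h
  have key : (m + 2).factorial * ∑ j ∈ Finset.Ico 1 (m + 2),
      ((m + 2 : ℕ) - j : ℚ) * (cycleWeight j * cycleWeight (m + 2 - j)) =
      (m + 1) * (m + 2) ^ (m + 1) := by
    rw [Finset.sum_Ico_eq_sum_range, Finset.mul_sum]
    trans ((m + 1 : ℕ) + 1 : ℚ) * ((m + 1 : ℕ) + 1) ^ (m + 1) - ((m + 1 : ℕ) + 1) ^ (m + 1)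
    · rw [← h]
      simp only [Nat.choose_self, sub_self, Nat.sub_self, pow_zero, Nat.cast_one, one_mul, mul_one,
        add_sub_cancel_right]
      refine Finset.sum_congr rfl fun k hk => ?_
      have hk : k < m + 1 := by simpa using hk
      rw [hw _ (by omega), hw _ (by omega), Nat.cast_choose ℚ (by omega : k + 1 ≤ m + 1 + 1)]
      obtain ⟨j, rfl⟩ : ∃ j, m = k + j := ⟨m - k, by omega⟩
      rw [show k + j + 2 - (1 + k) = j + 1 by omega,
        show k + j + 1 + 1 - (k + 1) = j + 1 by omega, show k + j + 1 - k = j + 1 by omega,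
        add_comm 1 k]
      have h1 := Nat.factorial_ne_zero (k + 1)
      have h2 := Nat.factorial_ne_zero (j + 1)
      push_cast
      rw [show (k : ℚ) + j + 1 - k = j + 1 by ring, show (k : ℚ) + j + 2 - (k + 1) = j + 1 by ring]
      field_simp
      ring
    · push_cast; ring
  have h1 : ((m + 2).factorial : ℚ) ≠ 0 := by exact_mod_cast Nat.factorial_ne_zero _
  apply mul_left_cancel₀ h1
  rw [mul_left_comm, key, hw _ (by omega)]
  push_cast
  field_simp
  ring

theorem cycleWeight_pos {n : ℕ} (hn : 1 ≤ n) : 0 < cycleWeight n := by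
  unfold cycleWeight
  positivity

namespace Equiv.Perm

variable {V : Type*} [Fintype V] [DecidableEq V]

/-- The minimal number of transpositions whose product is `π`. -/
def swapLength (π : Perm V) : ℕ := (π.cycleType.map (· - 1)).sum

/-- The product of the weights of the cycles of `π`. -/
noncomputable def weight (π : Perm V) : ℚ := (π.cycleType.map cycleWeight).prod

theorem Disjoint.swapLength_mul {σ τ : Perm V} (h : Disjoint σ τ) :
    (σ * τ).swapLength = σ.swapLength + τ.swapLength := by
  simp [swapLength, h.cycleType_mul]

theorem Disjoint.weight_mul {σ τ : Perm V} (h : Disjoint σ τ) :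
    (σ * τ).weight = σ.weight * τ.weight := by
  simp [weight, h.cycleType_mul]

theorem swapLength_one : (1 : Perm V).swapLength = 0 := by simp [swapLength]

theorem weight_one : (1 : Perm V).weight = 1 := by simp [weight]

theorem swapLength_formPerm {l : List V} (hl : l.Nodup) :
    l.formPerm.swapLength = l.length - 1 := by
  by_cases hn : 2 ≤ l.length
  · rw [swapLength, (List.isCycle_formPerm hl hn).cycleType, List.support_formPerm_of_nodup l hl
      (by rintro x rfl; simp at hn), List.toFinset_card_of_nodup hl]
    simp
  · rw [(List.formPerm_eq_one_iff l hl).2 (by omega), swapLength_one]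
    omega

theorem weight_formPerm {l : List V} (hl : l.Nodup) (h0 : l ≠ []) :
    l.formPerm.weight = cycleWeight l.length := by
  by_cases hn : 2 ≤ l.length
  · rw [weight, (List.isCycle_formPerm hl hn).cycleType, List.support_formPerm_of_nodup l hl
      (by rintro x rfl; simp at hn), List.toFinset_card_of_nodup hl]
    simp
  · have h1 : l.length = 1 := by have := List.length_pos_of_ne_nil h0; omega
    rw [(List.formPerm_eq_one_iff l hl).2 (by omega), weight_one, h1]
    simp [cycleWeight]

theorem eq_one_of_swapLength_eq_zero {π : Perm V} (h : π.swapLength = 0) : π = 1 := by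
  rw [← cycleType_eq_zero, Multiset.eq_zero_iff_forall_notMem]
  intro n hn
  have h2 := two_le_of_mem_cycleType hn
  have := Multiset.le_sum_of_mem (Multiset.mem_map_of_mem (· - 1) hn)
  have h' : (π.cycleType.map (· - 1)).sum = 0 := h
  omega

theorem swap_mul_formPerm_append {W : Type*} [DecidableEq W] {a b : W} {l m : List W}
    (h : (a :: l ++ b :: m).Nodup) :
    swap a b * (a :: l ++ b :: m).formPerm = (a :: l).formPerm * (b :: m).formPerm := by
  induction l generalizing a with
  | nil => simp [List.formPerm_cons_cons, swap_mul_self_mul]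
  | cons c l ih =>
    have hc := ih (a := c) (List.Nodup.of_cons h)
    have hac : a ≠ c := by rintro rfl; simp at h
    have hab : a ≠ b := by rintro rfl; simp at h
    have hcb : c ≠ b := by rintro rfl; simp at h
    rw [List.cons_append] at hc
    rw [List.cons_append, List.cons_append, List.formPerm_cons_cons, List.formPerm_cons_cons,
      mul_assoc, ← hc, ← mul_assoc, ← mul_assoc]
    congr 1
    rw [mul_swap_eq_swap_mul (swap a c), swap_apply_right,
      swap_apply_of_ne_of_ne hab.symm hcb.symm]

/-- Splitting the cycle of `a` at the point `π ^ j a`. -/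
theorem swap_pow_mul {π : Perm V} {a : V} (ha : a ∈ π.support) {j : ℕ} (hj : 1 ≤ j)
    (hjn : j < (π.cycleOf a).support.card) :
    (swap a ((π ^ j) a) * π).swapLength + 1 = π.swapLength ∧
    (swap a ((π ^ j) a) * π).weight * cycleWeight (π.cycleOf a).support.card =
      π.weight * (cycleWeight j * cycleWeight ((π.cycleOf a).support.card - j)) := by
  set L := π.toList a with hL
  set ρ := π * (π.cycleOf a)⁻¹
  have hdisj : Disjoint ρ (π.cycleOf a) :=
    disjoint_mul_inv_of_mem_cycleFactorsFinset (cycleOf_mem_cycleFactorsFinset_iff.2 ha)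
  have hlen : L.length = (π.cycleOf a).support.card := length_toList π a
  have hnodup : L.Nodup := nodup_toList π a
  rw [← hlen] at hjn ⊢
  have hform : L.formPerm = π.cycleOf a := formPerm_toList π a
  have hπ : π = L.formPerm * ρ := by
    rw [hform, ← hdisj.commute.eq, inv_mul_cancel_right]
  have hρ : ∀ x ∈ L, ρ x = x := by
    intro x hx
    refine (hdisj x).resolve_right ?_
    rw [← Ne, ← mem_support, mem_support_cycleOf_iff]
    exact mem_toList_iff.1 hx
  obtain ⟨l, hl⟩ : ∃ l, L.take j = a :: l := by
    obtain ⟨x, l, hxl⟩ := List.exists_cons_of_length_pos (l := L.take j)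
      (by rw [List.length_take]; omega)
    have : (L.take j)[0]? = some a := by
      rw [List.getElem?_take_of_lt (by omega), List.getElem?_eq_getElem (by omega)]
      simp [hL, getElem_toList]
    rw [hxl] at this
    exact ⟨l, by simpa [hxl] using this⟩
  obtain ⟨m, hm⟩ : ∃ m, L.drop j = (π ^ j) a :: m := by
    refine ⟨L.drop (j + 1), ?_⟩
    rw [List.drop_eq_getElem_cons hjn]
    simp [hL, getElem_toList]
  have hLlm : L = (a :: l) ++ ((π ^ j) a :: m) := by rw [← hl, ← hm, List.take_append_drop]
  have hl' : (a :: l).length = j := by rw [← hl, List.length_take]; omega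
  have hm' : ((π ^ j) a :: m).length = L.length - j := by rw [← hm, List.length_drop]
  set b := (π ^ j) a
  have hn := hLlm ▸ hnodup
  have hsplit : swap a b * π = (a :: l).formPerm * (b :: m).formPerm * ρ := by
    rw [← swap_mul_formPerm_append hn, ← hLlm, mul_assoc, ← hπ]
  have hn' := List.nodup_append'.1 hn
  have hd1 : Disjoint (a :: l).formPerm (b :: m).formPerm := by
    intro x
    by_cases hx : x ∈ a :: l
    · exact Or.inr (List.formPerm_apply_of_notMem (hn'.2.2 hx))
    · exact Or.inl (List.formPerm_apply_of_notMem hx)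
  have hd2 : Disjoint ((a :: l).formPerm * (b :: m).formPerm) ρ := by
    intro x
    by_cases hx : x ∈ L
    · exact Or.inr (hρ x hx)
    · rw [hLlm, List.mem_append, not_or] at hx
      left
      rw [mul_apply, List.formPerm_apply_of_notMem hx.2, List.formPerm_apply_of_notMem hx.1]
  have hd3 : Disjoint L.formPerm ρ := hform ▸ hdisj.symm
  have hL0 : L ≠ [] := by rw [hLlm]; simp
  constructor
  · rw [hsplit, hd2.swapLength_mul, hd1.swapLength_mul, swapLength_formPerm hn'.1,
      swapLength_formPerm hn'.2.1, hl', hm']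
    conv_rhs => rw [hπ, hd3.swapLength_mul, swapLength_formPerm hnodup]
    omega
  · rw [hsplit, hd2.weight_mul, hd1.weight_mul, weight_formPerm hn'.1 (by simp),
      weight_formPerm hn'.2.1 (by simp), hl', hm']
    conv_rhs => rw [hπ, hd3.weight_mul, weight_formPerm hnodup hL0]
    ring

theorem SameCycle.exists_pow_eq_of_ne {π : Perm V} {a b : V} (h : π.SameCycle a b) (hab : a ≠ b) :
    a ∈ π.support ∧ ∃ j, 1 ≤ j ∧ j < (π.cycleOf a).support.card ∧ (π ^ j) a = b := by
  have ha : a ∈ π.support := by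
    rw [mem_support]
    intro ha
    exact hab (h.eq_of_left ha)
  refine ⟨ha, ?_⟩
  obtain ⟨j, hj, hjb⟩ := h.exists_pow_eq_of_mem_support ha
  refine ⟨j, Nat.pos_of_ne_zero ?_, hj, hjb⟩
  rintro rfl
  exact hab hjb

theorem swapLength_swap_mul_of_sameCycle {π : Perm V} {a b : V} (h : π.SameCycle a b)
    (hab : a ≠ b) : (swap a b * π).swapLength + 1 = π.swapLength := by
  obtain ⟨ha, j, hj, hjn, rfl⟩ := h.exists_pow_eq_of_ne hab
  exact (swap_pow_mul ha hj hjn).1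

theorem sameCycle_swap_mul {π : Perm V} {a b : V} (h : ¬ π.SameCycle a b) :
    (swap a b * π).SameCycle a b := by
  have hper : a ∈ Function.periodicPts π :=
    Function.Injective.mem_periodicPts π.injective a
  set n := Function.minimalPeriod π a with hn
  have hn0 : 0 < n := Function.minimalPeriod_pos_of_mem_periodicPts hper
  have key : ∀ i, i < n → ((swap a b * π) ^ i) a = (π ^ i) a := by
    intro i
    induction i with
    | zero => simp
    | succ i ih =>
      intro hi
      rw [pow_succ', mul_apply, ih (by omega), mul_apply, ← mul_apply π, ← pow_succ']
      refine swap_apply_of_ne_of_ne ?_ ?_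
      · intro hia
        refine Function.not_isPeriodicPt_of_pos_of_lt_minimalPeriod (Nat.succ_ne_zero i) hi ?_
        rw [Function.IsPeriodicPt, Function.IsFixedPt, iterate_eq_pow]
        exact hia
      · intro hib
        exact h ⟨(i + 1 : ℕ), by rw [zpow_natCast]; exact hib⟩
  refine ⟨(n : ℕ), ?_⟩
  obtain ⟨i, hi⟩ : ∃ i, n = i + 1 := ⟨n - 1, by omega⟩
  rw [zpow_natCast, hi, pow_succ', mul_apply, key i (by omega), mul_apply, ← mul_apply π,
    ← pow_succ', ← hi]
  have : (π ^ n) a = a := by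
    rw [← iterate_eq_pow]
    exact Function.isPeriodicPt_minimalPeriod π a
  rw [this, swap_apply_left]

theorem swapLength_swap_mul_of_not_sameCycle {π : Perm V} {a b : V} (h : ¬ π.SameCycle a b) :
    (swap a b * π).swapLength = π.swapLength + 1 := by
  have hab : a ≠ b := by rintro rfl; exact h (SameCycle.refl _ _)
  rw [← swapLength_swap_mul_of_sameCycle (sameCycle_swap_mul h) hab, swap_mul_self_mul]

theorem swapLength_prod_le (l : List (Perm V)) (hl : ∀ τ ∈ l, τ.IsSwap) :
    l.prod.swapLength ≤ l.length := by
  induction l with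
  | nil => simp [swapLength_one]
  | cons τ l ih =>
    obtain ⟨a, b, hab, rfl⟩ := hl τ (by simp)
    have := ih fun σ hσ => hl σ (by simp [hσ])
    rw [List.prod_cons, List.length_cons]
    by_cases h : l.prod.SameCycle a b
    · have := swapLength_swap_mul_of_sameCycle h hab
      omega
    · have := swapLength_swap_mul_of_not_sameCycle h
      omega

/-- The lists of `r` transpositions with product `π`. -/
abbrev SwapFactorization (r : ℕ) (π : Perm V) : Type _ :=
  {l : List (Perm V) // l.length = r ∧ (∀ τ ∈ l, τ.IsSwap) ∧ l.prod = π}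

instance (r : ℕ) (π : Perm V) : Finite (SwapFactorization r π) :=
  Set.Finite.subset (List.finite_length_eq (Perm V) r) fun _ hl => hl.1

theorem card_swapFactorization_of_lt {r : ℕ} {π : Perm V} (h : r < π.swapLength) :
    Nat.card (SwapFactorization r π) = 0 := by
  have : IsEmpty (SwapFactorization r π) := by
    refine ⟨fun ⟨l, hl, hs, hp⟩ => ?_⟩
    have := swapLength_prod_le l hs
    rw [hp] at this
    omega
  exact Nat.card_of_isEmpty

theorem card_subtype_length_zero_prod_eq_one {G : Type*} [Monoid G] (P : G → Prop) :
    Nat.card {l : List G // l.length = 0 ∧ (∀ τ ∈ l, P τ) ∧ l.prod = 1} = 1 := by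
  rw [Nat.card_eq_one_iff_unique]
  refine ⟨⟨fun x y => ?_⟩, ⟨⟨[], by simp⟩⟩⟩
  exact Subtype.ext ((List.length_eq_zero_iff.1 x.2.1).trans (List.length_eq_zero_iff.1 y.2.1).symm)

/-- Removing the first transposition of a factorization. -/
def swapFactorizationSuccEquiv (r : ℕ) (π : Perm V) :
    SwapFactorization (r + 1) π ≃
      Σ τ : {τ : Perm V // τ.IsSwap}, SwapFactorization r (τ.1 * π) where
  toFun
    | ⟨τ :: l, h⟩ => ⟨⟨τ, h.2.1 τ (by simp)⟩, ⟨l, by simpa using h.1,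
        fun σ hσ => h.2.1 σ (by simp [hσ]), by
          have hτ : τ * τ = 1 := by
            obtain ⟨a, b, -, rfl⟩ := h.2.1 τ (by simp)
            exact swap_mul_self a b
          have hp : τ * l.prod = π := by rw [← List.prod_cons, h.2.2]
          change l.prod = τ * π
          rw [← hp, ← mul_assoc, hτ, one_mul]⟩⟩
    | ⟨[], h⟩ => absurd h.1 (by simp)
  invFun x := ⟨x.1.1 :: x.2.1, by simp [x.2.2.1], by
    intro σ hσ
    rcases List.mem_cons.1 hσ with rfl | hσ
    · exact x.1.2
    · exact x.2.2.2.1 σ hσ, by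
    have hτ : x.1.1 * x.1.1 = 1 := by
      obtain ⟨a, b, -, hab⟩ := x.1.2
      rw [hab, swap_mul_self a b]
    rw [List.prod_cons, x.2.2.2.2, ← mul_assoc, hτ, one_mul]⟩
  left_inv
    | ⟨τ :: l, h⟩ => rfl
    | ⟨[], h⟩ => absurd h.1 (by simp)
  right_inv _ := rfl

theorem swap_eq_swap_iff {W : Type*} [DecidableEq W] {a b x y : W} (hab : a ≠ b) :
    swap a b = swap x y ↔ a = x ∧ b = y ∨ a = y ∧ b = x := by
  constructor
  · intro h
    have ha : b = swap x y a := by rw [← h, swap_apply_left]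
    rw [swap_apply_def] at ha
    grind
  · rintro (⟨rfl, rfl⟩ | ⟨rfl, rfl⟩)
    · rfl
    · exact swap_comm _ _

theorem two_mul_sum_isSwap {M : Type*} [Semiring M] [DecidablePred (IsSwap : Perm V → Prop)]
    (f : Perm V → M) :
    2 * ∑ τ : {τ : Perm V // τ.IsSwap}, f τ.1 =
      ∑ a, ∑ b ∈ Finset.univ.erase a, f (swap a b) := by
  rw [Finset.sum_sigma', Finset.mul_sum]
  have hmaps : ∀ x ∈ Finset.univ.sigma fun a : V => Finset.univ.erase a,
      swap x.1 x.2 ∈ Finset.univ.filter (IsSwap : Perm V → Prop) := by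
    rintro ⟨a, b⟩ hx
    simp only [Finset.mem_sigma, Finset.mem_univ, Finset.mem_erase, true_and, and_true] at hx
    simpa using ⟨a, b, Ne.symm hx, rfl⟩
  rw [← Finset.sum_fiberwise_of_maps_to hmaps]
  rw [← Finset.sum_subtype (p := IsSwap) (Finset.univ.filter (IsSwap : Perm V → Prop)) (by simp)
    fun τ => 2 * f τ]
  refine Finset.sum_congr rfl fun τ hτ => ?_
  obtain ⟨x, y, hxy, rfl⟩ : τ.IsSwap := by simpa using hτ
  have hfib : ((Finset.univ.sigma fun a : V => Finset.univ.erase a).filter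
      fun p => swap p.1 p.2 = swap x y) = {⟨x, y⟩, ⟨y, x⟩} := by
    ext ⟨a, b⟩
    simp only [Finset.mem_filter, Finset.mem_sigma, Finset.mem_univ, Finset.mem_erase, true_and,
      and_true, Finset.mem_insert, Finset.mem_singleton, Sigma.mk.injEq, heq_eq_eq]
    constructor
    · rintro ⟨hab, h⟩
      exact (swap_eq_swap_iff (Ne.symm hab)).1 h
    · rintro (⟨rfl, rfl⟩ | ⟨rfl, rfl⟩)
      · exact ⟨hxy.symm, rfl⟩
      · exact ⟨hxy, swap_comm _ _⟩
  rw [hfib, Finset.sum_pair (by simpa using fun h => absurd h hxy), swap_comm y x, two_mul]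

theorem card_swapFactorization_succ (r : ℕ) (π : Perm V) :
    2 * Nat.card (SwapFactorization (r + 1) π) =
      ∑ a, ∑ b ∈ Finset.univ.erase a, Nat.card (SwapFactorization r (swap a b * π)) := by
  classical
  rw [Nat.card_congr (swapFactorizationSuccEquiv r π), Nat.card_sigma,
    ← two_mul_sum_isSwap fun τ => Nat.card (SwapFactorization r (τ * π))]

/-- Sum over the support of a function of the length of the cycle of each point. -/
theorem sum_support_card_cycleOf (π : Perm V) (f : ℕ → ℚ) :
    ∑ a ∈ π.support, f (π.cycleOf a).support.card =
      (π.cycleType.map fun n => n * f n).sum := by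
  have hsupp : π.support = π.cycleFactorsFinset.biUnion support := by
    ext x
    simp [mem_support_iff_mem_support_of_mem_cycleFactorsFinset (g := π)]
  rw [hsupp, Finset.sum_biUnion, cycleType_def, Multiset.map_map]
  · refine Finset.sum_congr rfl fun c hc => ?_
    rw [Finset.sum_congr rfl fun a ha => by rw [← cycle_is_cycleOf ha hc]]
    simp
  · intro c hc c' hc' hne
    exact (cycleFactorsFinset_pairwise_disjoint π hc hc' hne).disjoint_support

/-- The total contribution of the transpositions splitting the cycle of `a`. -/
theorem sum_card_swapFactorization_swap_mul {r : ℕ} {π : Perm V} (hr : π.swapLength = r + 1)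
    (ih : ∀ σ : Perm V, σ.swapLength = r →
      (Nat.card (SwapFactorization r σ) : ℚ) = r.factorial * σ.weight)
    {a : V} (ha : a ∈ π.support) :
    ∑ b ∈ Finset.univ.erase a, (Nat.card (SwapFactorization r (swap a b * π)) : ℚ) =
      r.factorial * π.weight *
        (2 * ((π.cycleOf a).support.card - 1) / (π.cycleOf a).support.card) := by
  set n := (π.cycleOf a).support.card with hn
  have hn2 : 2 ≤ n := two_le_card_support_cycleOf_iff.2 (mem_support.1 ha)
  have hinj : Set.InjOn (fun j => (π ^ j) a) (Finset.Ico 1 n) := by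
    intro i hi j hj hij
    simp only [Finset.coe_Ico, Set.mem_Ico] at hi hj
    have hlen : (π.toList a).length = n := length_toList π a
    refine (nodup_toList π a).getElem_inj_iff (hi := by omega) (hj := by omega) |>.1 ?_
    simpa [getElem_toList] using hij
  have hsub : (Finset.Ico 1 n).image (fun j => (π ^ j) a) ⊆ Finset.univ.erase a := by
    intro b hb
    obtain ⟨j, hj, rfl⟩ := Finset.mem_image.1 hb
    rw [Finset.mem_Ico] at hj
    refine Finset.mem_erase.2 ⟨fun h => ?_, Finset.mem_univ _⟩
    have hlen : (π.toList a).length = n := length_toList π a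
    have : j = 0 := by
      refine (nodup_toList π a).getElem_inj_iff (hi := by omega) (hj := by omega) |>.1 ?_
      simpa [getElem_toList] using h
    omega
  rw [← Finset.sum_subset hsub, Finset.sum_image hinj]
  · have hw : cycleWeight n ≠ 0 := (cycleWeight_pos (by omega)).ne'
    have hterm : ∀ j ∈ Finset.Ico 1 n,
        (Nat.card (SwapFactorization r (swap a ((π ^ j) a) * π)) : ℚ) =
          r.factorial * π.weight / cycleWeight n * (cycleWeight j * cycleWeight (n - j)) := by
      intro j hj
      rw [Finset.mem_Ico] at hj
      obtain ⟨h1, h2⟩ := swap_pow_mul ha hj.1 hj.2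
      rw [ih _ (by omega), div_mul_eq_mul_div, eq_div_iff hw, mul_assoc, h2, mul_assoc]
    rw [Finset.sum_congr rfl hterm, ← Finset.mul_sum]
    have hn0 : (n : ℚ) ≠ 0 := by exact_mod_cast (by omega : n ≠ 0)
    have := sum_cycleWeight_mul n hn2
    field_simp
    linear_combination π.weight * this
  · intro b hb hb'
    have hba : a ≠ b := (Finset.ne_of_mem_erase hb).symm
    rw [card_swapFactorization_of_lt, Nat.cast_zero]
    rw [swapLength_swap_mul_of_not_sameCycle]
    · omega
    · intro h
      obtain ⟨-, j, hj, hjn, rfl⟩ := h.exists_pow_eq_of_ne hba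
      exact hb' (Finset.mem_image.2 ⟨j, Finset.mem_Ico.2 ⟨hj, hjn⟩, rfl⟩)

theorem card_swapFactorization (r : ℕ) (π : Perm V) (hr : π.swapLength = r) :
    (Nat.card (SwapFactorization r π) : ℚ) = r.factorial * π.weight := by
  induction r generalizing π with
  | zero =>
    obtain rfl := eq_one_of_swapLength_eq_zero hr
    rw [card_subtype_length_zero_prod_eq_one, weight_one]
    simp
  | succ r ih =>
    have h2 := congrArg (Nat.cast : ℕ → ℚ) (card_swapFactorization_succ r π)
    push_cast at h2
    have hfix : ∀ a ∈ Finset.univ, a ∉ π.support →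
        ∑ b ∈ Finset.univ.erase a, (Nat.card (SwapFactorization r (swap a b * π)) : ℚ) = 0 := by
      intro a _ ha
      refine Finset.sum_eq_zero fun b hb => ?_
      rw [card_swapFactorization_of_lt, Nat.cast_zero]
      rw [swapLength_swap_mul_of_not_sameCycle]
      · omega
      · exact fun h => ha (h.exists_pow_eq_of_ne (Finset.ne_of_mem_erase hb).symm).1
    rw [← Finset.sum_subset (Finset.subset_univ π.support) hfix,
      Finset.sum_congr rfl fun a ha => sum_card_swapFactorization_swap_mul hr ih ha,
      ← Finset.mul_sum, sum_support_card_cycleOf π fun n => 2 * ((n : ℚ) - 1) / n] at h2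
    have hsum : (π.cycleType.map fun n : ℕ => (n : ℚ) * (2 * ((n : ℚ) - 1) / n)).sum =
        2 * (r + 1) := by
      have : π.cycleType.map (fun n : ℕ => (n : ℚ) * (2 * ((n : ℚ) - 1) / n)) =
          π.cycleType.map fun n : ℕ => 2 * ((n - 1 : ℕ) : ℚ) := by
        refine Multiset.map_congr rfl fun n hn => ?_
        have := two_le_of_mem_cycleType hn
        have hn0 : (n : ℚ) ≠ 0 := by exact_mod_cast (by omega : n ≠ 0)
        rw [Nat.cast_sub (by omega)]
        field_simp
        simp
      rw [this, Multiset.sum_map_mul_left]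
      have h' := congrArg (Nat.cast : ℕ → ℚ) hr
      rw [swapLength, Nat.cast_multiset_sum, Multiset.map_map] at h'
      rw [show (r : ℚ) + 1 = ((r + 1 : ℕ) : ℚ) by push_cast; rfl, ← h']
      rfl
    rw [hsum] at h2
    rw [Nat.factorial_succ]
    push_cast
    linear_combination h2 / 2

end Equiv.Perm

theorem cycleWeight_eq_cay_div {n : ℕ} (hn : 1 ≤ n) :
    cycleWeight n = (cay (n - 1) : ℚ) / (n - 1).factorial := by
  rw [cycleWeight, cay, Nat.sub_add_cancel hn, Nat.sub_sub]

theorem one_le_of_mem_fullCycleType {d : ℕ} {π : Equiv.Perm (Fin d)} {n : ℕ}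
    (hn : n ∈ fullCycleType π) : 1 ≤ n := by
  rcases Multiset.mem_add.1 hn with h | h
  · exact (Equiv.Perm.one_lt_of_mem_cycleType h).le
  · exact (Multiset.eq_of_mem_replicate h).ge

theorem card_fullCycleType {d : ℕ} (π : Equiv.Perm (Fin d)) :
    (fullCycleType π).card = ell π := by
  simp [fullCycleType, ell]

theorem sum_fullCycleType {d : ℕ} (π : Equiv.Perm (Fin d)) : (fullCycleType π).sum = d := by
  have := π.support.card_le_univ
  simp only [Fintype.card_fin] at this
  simp only [fullCycleType, Multiset.sum_add, Equiv.Perm.sum_cycleType, Multiset.sum_replicate,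
    smul_eq_mul, mul_one]
  omega

theorem sum_map_sub_one_fullCycleType {d : ℕ} (π : Equiv.Perm (Fin d)) :
    ((fullCycleType π).map (· - 1)).sum = π.swapLength := by
  simp [fullCycleType, Equiv.Perm.swapLength]

theorem prod_map_cycleWeight_fullCycleType {d : ℕ} (π : Equiv.Perm (Fin d)) :
    ((fullCycleType π).map cycleWeight).prod = π.weight := by
  simp [fullCycleType, Equiv.Perm.weight, cycleWeight]

/-- Hurwitz, Cayley. If `π ∈ S_d` has cycle type `α = (α_1, …, α_k)` (parts
including fixed points, `k = ℓ(π)`), then the number of factorizations of `π` into the minimal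
number `d - k` of transpositions equals the multinomial coefficient
`(d-k choose α_1-1, …, α_k-1)` times `∏ i, Cay_{α_i - 1}`. -/
theorem swapFactorizationCount_min (d : ℕ) (hd : 1 ≤ d) (π : Equiv.Perm (Fin d))
    (k : ℕ) (hk : k = ell π) (α : Fin k → ℕ)
    (hα : (Multiset.ofList (List.ofFn α)) = fullCycleType π) :
    swapFactorizationCount d (d - k) π =
      Nat.multinomial Finset.univ (fun i => α i - 1) * ∏ i, cay (α i - 1) := by
  have hα1 : ∀ i, 1 ≤ α i := fun i =>
    one_le_of_mem_fullCycleType (hα ▸ Multiset.mem_coe.2 (List.mem_ofFn.2 ⟨i, rfl⟩))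
  have hsum : ∑ i, α i = d := by
    rw [← sum_fullCycleType π, ← hα, Multiset.sum_coe, List.sum_ofFn]
  have hlen : ∑ i, (α i - 1) = π.swapLength := by
    rw [← sum_map_sub_one_fullCycleType, ← hα, Multiset.map_coe, Multiset.sum_coe, List.map_ofFn,
      List.sum_ofFn]
    rfl
  have hweight : ∏ i, cycleWeight (α i) = π.weight := by
    rw [← prod_map_cycleWeight_fullCycleType, ← hα, Multiset.map_coe, Multiset.prod_coe,
      List.map_ofFn, List.prod_ofFn]
    rfl
  have hdk : d - k = π.swapLength := by
    have h : ∑ i, (α i - 1) + k = ∑ i, α i := by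
      rw [← Finset.sum_congr rfl fun i _ => Nat.sub_add_cancel (hα1 i), Finset.sum_add_distrib]
      simp
    omega
  have hcount : (swapFactorizationCount d (d - k) π : ℚ) = (d - k).factorial * π.weight :=
    Equiv.Perm.card_swapFactorization (d - k) π hdk.symm
  have hmult := congrArg (Nat.cast : ℕ → ℚ)
    (Nat.multinomial_spec Finset.univ fun i => α i - 1)
  rw [hlen, ← hdk] at hmult
  rw [← Nat.cast_inj (R := ℚ), hcount, ← hmult, ← hweight,
    Finset.prod_congr rfl fun i _ => cycleWeight_eq_cay_div (hα1 i), Finset.prod_div_distrib]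
  have h0 : ∏ i, ((α i - 1).factorial : ℚ) ≠ 0 :=
    Finset.prod_ne_zero_iff.2 fun i _ => by exact_mod_cast Nat.factorial_ne_zero _
  push_cast
  field_simp
end
end

section
/- Let d ≥ 1 and let Ω_q be the d! × d! complex matrix indexed by pairs of permutations ρ, σ ∈ S_d with entries (Ω_q)_{σρ} = q^{d − ℓ(ρ⁻¹σ)}, where ℓ counts cycles including fixed points. Then Ω_q is singular (det Ω_q = 0) if and only if d > 1 and q or −q equals one of the unit fractions 1/(d−1), 1/(d−2), …, 1/1. -/
noncomputable section

/-- The exponential distance matrix of the Hurwitz–Cayley graph: the `d! × d!` matrix whose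
`(σ, ρ)` entry is `q` raised to the graph distance `d - ℓ(ρ⁻¹σ)` between `ρ` and `σ`. -/
def Omega (d : ℕ) (q : ℂ) : Matrix (Equiv.Perm (Fin d)) (Equiv.Perm (Fin d)) ℂ :=
  Matrix.of fun σ ρ => q ^ (d - ell (ρ⁻¹ * σ))

open Equiv Equiv.Perm Finset

/-- The reflection length of a permutation: the sum of `n - 1` over its nontrivial cycle lengths. -/
def reflectionLength {d : ℕ} (π : Perm (Fin d)) : ℕ :=
  (π.cycleType.map fun n => n - 1).sum

theorem reflectionLength_one {d : ℕ} : reflectionLength (1 : Perm (Fin d)) = 0 := by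
  simp [reflectionLength]

theorem reflectionLength_mul_of_disjoint {d : ℕ} {σ τ : Perm (Fin d)} (h : σ.Disjoint τ) :
    reflectionLength (σ * τ) = reflectionLength σ + reflectionLength τ := by
  simp [reflectionLength, h.cycleType_mul]

theorem reflectionLength_of_isCycle {d : ℕ} {σ : Perm (Fin d)} (h : σ.IsCycle) :
    reflectionLength σ = #σ.support - 1 := by
  simp [reflectionLength, h.cycleType]

theorem sub_ell {d : ℕ} (π : Perm (Fin d)) : d - ell π = reflectionLength π := by
  have hle : #π.support ≤ d := by simpa using Finset.card_le_univ π.support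
  have hsum : reflectionLength π + π.cycleType.card = #π.support := by
    rw [← sum_cycleType, reflectionLength]
    have h : ∀ n ∈ π.cycleType, 1 ≤ n := fun n hn => one_lt_of_mem_cycleType hn |>.le
    generalize π.cycleType = m at h
    induction m using Multiset.induction_on with
    | empty => simp
    | cons a m ih =>
      have ha := h a (by simp)
      have := ih fun n hn => h n (by simp [hn])
      simp only [Multiset.map_cons, Multiset.sum_cons, Multiset.card_cons]
      omega
  unfold ell
  omega

theorem reflectionLength_swap_mul_of_isCycle {d : ℕ} {c : Perm (Fin d)} (hc : c.IsCycle)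
    {a : Fin d} (ha : c a ≠ a) :
    reflectionLength (swap a (c a) * c) + 1 = reflectionLength c := by
  by_cases h : c (c a) = a
  · have hs := hc.eq_swap_of_apply_apply_eq_self ha h
    have h1 : swap a (c a) * c = 1 := by
      nth_rw 2 [hs]
      simp
    rw [h1, reflectionLength_one, reflectionLength_of_isCycle hc, hs, card_support_swap ha.symm]
  · rw [reflectionLength_of_isCycle hc, reflectionLength_of_isCycle (hc.swap_mul ha h),
      support_swap_mul_eq _ _ h, sdiff_singleton_eq_erase, card_erase_of_mem (mem_support.2 ha)]
    have h2 := (hc.swap_mul ha h).two_le_card_support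
    rw [support_swap_mul_eq _ _ h, sdiff_singleton_eq_erase,
      card_erase_of_mem (mem_support.2 ha)] at h2
    omega

theorem reflectionLength_swap_mul {d : ℕ} {σ : Perm (Fin d)} {a : Fin d} (ha : σ a ≠ a) :
    reflectionLength (swap a (σ a) * σ) + 1 = reflectionLength σ := by
  set c := σ.cycleOf a with hc_def
  have hc : c.IsCycle := isCycle_cycleOf σ ha
  have hca : c a = σ a := cycleOf_apply_self σ a
  have hdis : c.Disjoint (σ * c⁻¹) :=
    (disjoint_mul_inv_of_mem_cycleFactorsFinset
      (cycleOf_mem_cycleFactorsFinset_iff.2 (mem_support.2 ha))).symm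
  have hσ : σ = c * (σ * c⁻¹) := by rw [hdis.commute.eq]; simp
  have hdis' : (swap a (c a) * c).Disjoint (σ * c⁻¹) := by
    refine Disjoint.mul_left ?_ hdis
    have hfix : ∀ x, c x ≠ x → (σ * c⁻¹) x = x := fun x hx => (hdis x).resolve_left hx
    have h1 := hfix a (by rwa [hca])
    have h2 := hfix (c a) fun h => ha (by rw [← hca]; exact c.injective h)
    intro x
    by_cases hxa : x = a
    · exact Or.inr (hxa ▸ h1)
    by_cases hxc : x = c a
    · exact Or.inr (hxc ▸ h2)
    exact Or.inl (swap_apply_of_ne_of_ne hxa hxc)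
  have h1 := reflectionLength_mul_of_disjoint hdis
  have h2 := reflectionLength_mul_of_disjoint hdis'
  have h3 := reflectionLength_swap_mul_of_isCycle hc (a := a) (by rwa [hca])
  rw [mul_assoc, ← hσ, hca] at h2
  rw [← hσ] at h1
  rw [hca] at h3
  omega

theorem reflectionLength_swap_mul_of_fixed {d : ℕ} {π : Perm (Fin d)} {a i : Fin d}
    (ha : π a = a) (hi : i ≠ a) :
    reflectionLength (swap a i * π) = reflectionLength π + 1 := by
  have h := reflectionLength_swap_mul (σ := swap a i * π) (a := a) (by simpa [ha])
  simpa [ha] using h.symm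

/-- The weighted sum `∑ q ^ |π| π` over the permutations `π` supported in `s`. -/
def weightedSum {d : ℕ} (q : ℂ) (s : Finset (Fin d)) : MonoidAlgebra ℂ (Perm (Fin d)) :=
  ∑ π : Perm (Fin d) with π.support ⊆ s,
    q ^ reflectionLength π • MonoidAlgebra.of ℂ (Perm (Fin d)) π

/-- The sum of the transpositions `(a i)` over `i ∈ s`. -/
def transpositionSum {d : ℕ} (a : Fin d) (s : Finset (Fin d)) :
    MonoidAlgebra ℂ (Perm (Fin d)) :=
  ∑ i ∈ s, MonoidAlgebra.of ℂ (Perm (Fin d)) (swap a i)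

theorem weightedSum_empty {d : ℕ} (q : ℂ) : weightedSum q (∅ : Finset (Fin d)) = 1 := by
  simp [weightedSum, Finset.filter_eq', reflectionLength_one, MonoidAlgebra.one_def]

theorem weightedSum_insert {d : ℕ} (q : ℂ) {a : Fin d} {s : Finset (Fin d)} (ha : a ∉ s) :
    weightedSum q (insert a s) = (1 + q • transpositionSum a s) * weightedSum q s := by
  have hfix : ∀ π : Perm (Fin d), π.support ⊆ s → π a = a := fun π hπ => by
    by_contra h
    exact ha (hπ (mem_support.2 h))
  have hfactor : 1 + q • transpositionSum a s = ∑ i ∈ insert a s,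
      (if i = a then 1 else q) • MonoidAlgebra.of ℂ (Perm (Fin d)) (swap a i) := by
    rw [sum_insert ha, transpositionSum, Finset.smul_sum]
    congr 1
    · rw [swap_self, if_pos rfl, one_smul]
      exact (map_one _).symm
    · refine sum_congr rfl fun i hi => ?_
      rw [if_neg (ne_of_mem_of_not_mem hi ha)]
  rw [hfactor, weightedSum, weightedSum, sum_mul_sum, ← sum_product']
  symm
  refine sum_nbij' (fun p => swap a p.1 * p.2) (fun σ => (σ a, swap a (σ a) * σ)) ?_ ?_ ?_ ?_ ?_
  · rintro ⟨i, π⟩ h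
    simp only [mem_product, mem_filter, mem_univ, true_and] at h ⊢
    intro x hx
    by_contra hxs
    have hxa : x ≠ a := fun h' => hxs (by simp [h'])
    have hxs' : x ∉ s := fun h' => hxs (by simp [h'])
    have hxi : x ≠ i := fun h' => hxs (h' ▸ h.1)
    have hπx : π x = x := by
      by_contra h'
      exact hxs' (h.2 (mem_support.2 h'))
    exact mem_support.1 hx (by simp [hπx, swap_apply_of_ne_of_ne hxa hxi])
  · intro σ h
    simp only [mem_product, mem_filter, mem_univ, true_and] at h ⊢
    refine ⟨?_, fun x hx => ?_⟩
    · by_cases hσ : σ a = a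
      · simp [hσ]
      · exact h (mem_support.2 fun h' => hσ (σ.injective h'))
    · have hx' := mem_support.1 hx
      have hxa : x ≠ a := by
        rintro rfl
        simp at hx'
      by_contra hxs
      have hσx : σ x = x := by
        by_contra h'
        have := h (mem_support.2 h')
        simp [hxa, hxs] at this
      refine hx' ?_
      rw [Perm.mul_apply, hσx]
      refine swap_apply_of_ne_of_ne hxa fun h' => hxa (σ.injective (hσx.trans h'))
  · rintro ⟨i, π⟩ h
    simp only [mem_product, mem_filter, mem_univ, true_and] at h
    simp [hfix π h.2]
  · intro σ _
    simp
  · rintro ⟨i, π⟩ h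
    simp only [mem_product, mem_filter, mem_univ, true_and] at h
    rw [smul_mul_smul_comm, ← map_mul]
    congr 1
    by_cases hi : i = a
    · rw [if_pos hi, one_mul, hi, swap_self, ← Perm.one_def, one_mul]
    · rw [if_neg hi, reflectionLength_swap_mul_of_fixed (hfix π h.2) hi, pow_succ']

/-- The initial segment of length `n + 1` adds the element `n` to the one of length `n`. -/
theorem filter_val_lt_succ {d n : ℕ} (hn : n < d) :
    (univ.filter fun i : Fin d => i.val < n + 1) = insert ⟨n, hn⟩ (Iio ⟨n, hn⟩) := by
  ext i
  simp only [mem_filter, mem_univ, true_and, mem_insert, mem_Iio, Fin.ext_iff, Fin.lt_def]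
  omega

theorem filter_val_lt {d n : ℕ} (hn : n < d) :
    (univ.filter fun i : Fin d => i.val < n) = Iio ⟨n, hn⟩ := by
  ext i
  simp [Fin.lt_def]

theorem weightedSum_filter_val_lt_succ {d n : ℕ} (q : ℂ) (hn : n < d) :
    weightedSum q (univ.filter fun i : Fin d => i.val < n + 1) =
      (1 + q • transpositionSum ⟨n, hn⟩ (Iio ⟨n, hn⟩)) *
        weightedSum q (univ.filter fun i : Fin d => i.val < n) := by
  rw [filter_val_lt_succ hn, filter_val_lt hn, weightedSum_insert q (by simp)]

/-- A Jucys–Murphy element is fixed under conjugation by permutations preserving its index set. -/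
theorem commute_of_transpositionSum {d : ℕ} {a : Fin d} {s : Finset (Fin d)}
    {π : Perm (Fin d)} (ha : π a = a) (hs : ∀ i, π i ∈ s ↔ i ∈ s) :
    Commute (MonoidAlgebra.of ℂ (Perm (Fin d)) π) (transpositionSum a s) := by
  unfold transpositionSum Commute SemiconjBy
  rw [mul_sum, sum_mul]
  refine sum_equiv π (fun i => (hs i).symm) fun i _ => ?_
  rw [← map_mul, ← map_mul, mul_swap_eq_swap_mul, ha]

theorem commute_transpositionSum_Iio {d : ℕ} {a b : Fin d} (hab : a < b) :
    Commute (transpositionSum a (Iio a)) (transpositionSum b (Iio b)) := by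
  refine Commute.sum_left _ _ _ fun i hi => ?_
  have hib : i < b := (mem_Iio.1 hi).trans hab
  refine commute_of_transpositionSum (swap_apply_of_ne_of_ne hab.ne' hib.ne') fun j => ?_
  rw [swap_apply_def]
  split_ifs <;> simp_all

theorem transpositionSum_succ_mul_swap {d n : ℕ} (hn : n + 1 < d) :
    let a : Fin d := ⟨n, by omega⟩
    let b : Fin d := ⟨n + 1, hn⟩
    let s := MonoidAlgebra.of ℂ (Perm (Fin d)) (swap a b)
    transpositionSum b (Iio b) * s = s * transpositionSum a (Iio a) + 1 := by
  intro a b s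
  have hb : Iio b = insert a (Iio a) := by
    ext i
    simp only [a, b, mem_insert, mem_Iio, Fin.ext_iff, Fin.lt_def]
    omega
  have hab : a ≠ b := by simp [a, b]
  rw [hb, transpositionSum, sum_insert (by simp), add_mul, add_comm]
  congr 1
  · rw [transpositionSum, mul_sum, sum_mul]
    refine sum_congr rfl fun i hi => ?_
    have hia : i < a := mem_Iio.1 hi
    have hib : i ≠ b := (hia.trans (by simp [a, b, Fin.lt_def])).ne
    rw [← map_mul, ← map_mul, mul_swap_eq_swap_mul (swap a b), swap_apply_left,
      swap_apply_of_ne_of_ne hia.ne hib]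
  · rw [← map_mul, swap_comm, swap_mul_self, map_one]

/-- Two commuting operators on a nonzero finite-dimensional complex space: every eigenvalue
of one of them is attained at a common eigenvector. -/
theorem exists_common_eigenvector {V : Type*} [AddCommGroup V] [Module ℂ V]
    [FiniteDimensional ℂ V] {f g : Module.End ℂ V} (h : Commute f g) {b : ℂ}
    (hb : g.HasEigenvalue b) : ∃ y ≠ 0, ∃ a : ℂ, f y = a • y ∧ g y = b • y := by
  have hmap : ∀ x ∈ g.eigenspace b, f x ∈ g.eigenspace b :=
    Module.End.mapsTo_genEigenspace_of_comm h.symm b 1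
  have : Nontrivial (g.eigenspace b) := Submodule.nontrivial_iff_ne_bot.2 hb
  obtain ⟨a, ha⟩ := Module.End.exists_eigenvalue (f.restrict hmap)
  obtain ⟨y, hy⟩ := ha.exists_hasEigenvector
  refine ⟨y, by simpa using hy.2, a, ?_, Module.End.mem_eigenspace_iff.1 y.2⟩
  simpa using congrArg Subtype.val hy.apply_eq_smul

/-- One step of the degenerate affine Hecke algebra argument: if `K s = s J + 1` with `s² = 1`
and `J`, `K` commute, then the eigenvalues of `K` differ by at most one from those of `J`. -/
theorem exists_eigenvalue_of_mul_eq_mul_add_one {A : Type*} [Ring A] [Algebra ℂ A]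
    [FiniteDimensional ℂ A] {J K s : A} (hs : s * s = 1) (hJK : Commute J K)
    (hK : K * s = s * J + 1) {x : A} (hx : x ≠ 0) {b : ℂ} (hxK : x * K = b • x) :
    ∃ y ≠ 0, ∃ c : ℂ, y * J = c • y ∧ (b = c ∨ b = c + 1 ∨ b = c - 1) := by
  have hcomm : Commute (LinearMap.mulRight ℂ J) (LinearMap.mulRight ℂ K) := by
    ext z
    simp [mul_assoc, hJK.eq]
  have hb : Module.End.HasEigenvalue (LinearMap.mulRight ℂ K) b :=
    Module.End.hasEigenvalue_of_hasEigenvector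
      ⟨Module.End.mem_eigenspace_iff.2 (by simpa using hxK), hx⟩
  obtain ⟨y, hy, a, hyJ, hyK⟩ := exists_common_eigenvector hcomm hb
  simp only [LinearMap.mulRight_apply] at hyJ hyK
  by_cases hab : a = b
  · exact ⟨y, hy, a, hyJ, Or.inl hab.symm⟩
  have hab' : a - b ≠ 0 := sub_ne_zero.2 hab
  set c := (a - b)⁻¹ with hc
  have hc1 : c * (a - b) = 1 := inv_mul_cancel₀ hab'
  by_cases hw : y * s + c • y = 0
  · have h1 : y * s = -c • y := by
      rw [neg_smul]
      exact eq_neg_of_add_eq_zero_left hw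
    have h2 : (c ^ 2 - 1) • y = 0 := by
      have h3 : y * s * s = y := by rw [mul_assoc, hs, mul_one]
      rw [h1, smul_mul_assoc, h1, smul_smul] at h3
      rw [sub_smul, one_smul, sub_eq_zero]
      convert h3 using 2
      ring
    have h3 : (c - 1) * (c + 1) = 0 := by
      linear_combination (smul_eq_zero.1 h2).resolve_right hy
    refine ⟨y, hy, a, hyJ, Or.inr ?_⟩
    rcases mul_eq_zero.1 h3 with h | h
    · right
      linear_combination (a - b) * h - hc1
    · left
      linear_combination hc1 - (a - b) * h
  · refine ⟨_, hw, b, ?_, Or.inl rfl⟩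
    have hsJ : y * s * J = b • (y * s) - y := by
      rw [mul_assoc, eq_sub_of_add_eq hK.symm, mul_sub, mul_one, ← mul_assoc, hyK, smul_mul_assoc]
    rw [add_mul, smul_mul_assoc, hsJ, hyJ, smul_add, smul_smul, smul_smul]
    have : c * a = b * c + 1 := by linear_combination hc1
    rw [this, add_smul, one_smul]
    abel

instance {d : ℕ} : FiniteDimensional ℂ (MonoidAlgebra ℂ (Perm (Fin d))) :=
  Module.Finite.equiv (MonoidAlgebra.coeffLinearEquiv ℂ).symm

/-- The eigenvalues of the Jucys–Murphy element attached to `n` are integers in `[-n, n]`. -/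
theorem eigenvalue_transpositionSum_Iio {d n : ℕ} (hn : n < d)
    {x : MonoidAlgebra ℂ (Perm (Fin d))} (hx : x ≠ 0) {b : ℂ}
    (hb : x * transpositionSum ⟨n, hn⟩ (Iio ⟨n, hn⟩) = b • x) :
    ∃ m : ℤ, |m| ≤ n ∧ b = m := by
  induction n generalizing x b with
  | zero =>
    have h : Iio (⟨0, hn⟩ : Fin d) = ∅ := by
      ext i
      simp [Fin.lt_def]
    rw [h, transpositionSum, sum_empty, mul_zero] at hb
    exact ⟨0, by simp, by simpa [hx] using hb.symm⟩
  | succ n ih =>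
    obtain ⟨y, hy, c, hyc, hbc⟩ := exists_eigenvalue_of_mul_eq_mul_add_one
      (by rw [← map_mul, swap_mul_self, map_one])
      (commute_transpositionSum_Iio (by simp [Fin.lt_def]))
      (transpositionSum_succ_mul_swap hn) hx hb
    obtain ⟨m, hm, rfl⟩ := ih (by omega) hy hyc
    rw [abs_le] at hm
    rcases hbc with rfl | rfl | rfl
    · exact ⟨m, abs_le.2 (by push_cast; omega), rfl⟩
    · exact ⟨m + 1, abs_le.2 (by push_cast; omega), by push_cast; rfl⟩
    · exact ⟨m - 1, abs_le.2 (by push_cast; omega), by push_cast; rfl⟩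

theorem eq_zero_of_mul_weightedSum_eq_zero {d : ℕ} {q : ℂ}
    (hq : ∀ k : ℕ, 1 ≤ k → k ≤ d - 1 → q ≠ 1 / k ∧ -q ≠ 1 / k) {n : ℕ} (hn : n ≤ d)
    {x : MonoidAlgebra ℂ (Perm (Fin d))}
    (hx : x * weightedSum q (univ.filter fun i : Fin d => i.val < n) = 0) : x = 0 := by
  induction n generalizing x with
  | zero => simpa [weightedSum_empty] using hx
  | succ n ih =>
    rw [weightedSum_filter_val_lt_succ q hn, ← mul_assoc] at hx
    have hx' := ih (by omega) hx
    by_contra hx0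
    rw [mul_add, mul_one, mul_smul_comm] at hx'
    have hq0 : q ≠ 0 := by
      rintro rfl
      exact hx0 (by simpa using hx')
    obtain ⟨m, hm, hqm⟩ := eigenvalue_transpositionSum_Iio (b := -q⁻¹) hn hx0 (by
      rw [neg_smul, eq_neg_iff_add_eq_zero]
      have h := congrArg (q⁻¹ • ·) hx'
      simp only [smul_add, smul_smul, inv_mul_cancel₀ hq0, one_smul, smul_zero] at h
      rw [add_comm]
      exact h)
    have hm0 : m ≠ 0 := by
      rintro rfl
      simp [hq0] at hqm
    have hqm' : -q = 1 / m := by rw [← hqm]; simp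
    rw [abs_le] at hm
    have hk := hq m.natAbs (by omega) (by omega)
    rcases Int.natAbs_eq m with h | h
    · refine hk.2 (hqm'.trans ?_)
      rw [h]
      simp
    · refine hk.1 ?_
      rw [← neg_neg q, hqm', h]
      simp

/-- The character sums of the weights vanish when a Jucys–Murphy factor does. -/
theorem sum_pow_reflectionLength_mul_eq_zero {d k : ℕ} {q c : ℂ} (χ : Perm (Fin d) →* ℂ)
    (hχ : ∀ i j, i ≠ j → χ (swap i j) = c) (hk : k < d) (hq : 1 + q * (k * c) = 0) :
    ∑ π, q ^ reflectionLength π * χ π = 0 := by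
  set Φ := MonoidAlgebra.lift ℂ ℂ (Perm (Fin d)) χ
  have hof : ∀ π, Φ (MonoidAlgebra.of ℂ (Perm (Fin d)) π) = χ π := fun π => by simp [Φ]
  have hzero : ∀ n, k < n → n ≤ d →
      Φ (weightedSum q (univ.filter fun i : Fin d => i.val < n)) = 0 := by
    intro n hkn
    induction n, hkn using Nat.le_induction with
    | base =>
      intro hn
      have hsum : Φ (transpositionSum ⟨k, hk⟩ (Iio ⟨k, hk⟩)) = k * c := by
        rw [transpositionSum, map_sum, sum_congr rfl fun i hi => by
          rw [hof, hχ _ _ (mem_Iio.1 hi).ne']]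
        simp
      rw [weightedSum_filter_val_lt_succ q hk, map_mul, map_add, map_one, map_smul, hsum,
        smul_eq_mul, hq, zero_mul]
    | succ n _ ih =>
      intro hn
      rw [weightedSum_filter_val_lt_succ q hn, map_mul, ih (by omega), mul_zero]
  have h := hzero d hk le_rfl
  simpa only [weightedSum, map_sum, map_smul, hof, smul_eq_mul, Fin.is_lt, filter_true,
    subset_univ] using h

theorem Omega_apply {d : ℕ} (q : ℂ) (σ ρ : Perm (Fin d)) :
    Omega d q σ ρ = q ^ reflectionLength (ρ⁻¹ * σ) := by
  simp [Omega, sub_ell]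

theorem Omega_det_eq_zero_of_character {d k : ℕ} {q c : ℂ} (χ : Perm (Fin d) →* ℂ)
    (hχ : ∀ i j, i ≠ j → χ (swap i j) = c) (hk : k < d) (hq : 1 + q * (k * c) = 0) :
    (Omega d q).det = 0 := by
  rw [← Matrix.exists_vecMul_eq_zero_iff]
  refine ⟨χ, fun h => one_ne_zero (α := ℂ) ?_, ?_⟩
  · rw [← map_one χ, h, Pi.zero_apply]
  · ext ρ
    simp only [Matrix.vecMul, dotProduct, Omega_apply, Pi.zero_apply]
    rw [← Equiv.sum_comp (Equiv.mulLeft ρ), ← mul_zero (χ ρ),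
      ← sum_pow_reflectionLength_mul_eq_zero χ hχ hk hq, mul_sum]
    refine sum_congr rfl fun π _ => ?_
    simp only [Equiv.coe_mulLeft, map_mul, inv_mul_cancel_left]
    ring

theorem sum_smul_of_mul_weightedSum {d : ℕ} (q : ℂ) (v : Perm (Fin d) → ℂ) :
    (∑ ρ, v ρ • MonoidAlgebra.of ℂ (Perm (Fin d)) ρ) * weightedSum q univ =
      ∑ σ, (Omega d q).mulVec v σ • MonoidAlgebra.of ℂ (Perm (Fin d)) σ := by
  simp only [weightedSum, subset_univ, filter_true, sum_mul_sum, Matrix.mulVec, dotProduct,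
    Omega_apply, Finset.sum_smul]
  rw [sum_comm (s := univ) (t := univ) (f := fun σ ρ =>
    (q ^ reflectionLength (ρ⁻¹ * σ) * v ρ) • MonoidAlgebra.of ℂ (Perm (Fin d)) σ)]
  refine sum_congr rfl fun ρ _ => ?_
  refine Fintype.sum_equiv (Equiv.mulLeft ρ) _ _ fun π => ?_
  rw [smul_mul_smul_comm, ← map_mul, Equiv.coe_mulLeft, inv_mul_cancel_left, mul_comm (v ρ)]

theorem eq_zero_of_sum_smul_of_eq_zero {G : Type*} [Group G] [Fintype G] {v : G → ℂ}
    (h : ∑ g, v g • MonoidAlgebra.of ℂ G g = 0) : v = 0 := by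
  classical
  ext g
  have := congrArg (fun x : MonoidAlgebra ℂ G => x.coeff g) h
  simpa [Finsupp.single_apply] using this

/-- The exponential distance matrix `Ω_q` of the Hurwitz–Cayley graph of
degree `d` is singular if and only if `d > 1` and `q` or `-q` is one of the unit fractions
`1/(d-1), 1/(d-2), …, 1/1`. -/
theorem Omega_det_eq_zero_iff (d : ℕ) (hd : 1 ≤ d) (q : ℂ) :
    (Omega d q).det = 0 ↔
      (1 < d ∧ ∃ k : ℕ, 1 ≤ k ∧ k ≤ d - 1 ∧ (q = 1 / k ∨ -q = 1 / k)) := by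
  constructor
  · intro hdet
    by_contra hcon
    have hq : ∀ k : ℕ, 1 ≤ k → k ≤ d - 1 → q ≠ 1 / k ∧ -q ≠ 1 / k := fun k h1 h2 =>
      not_or.1 fun h => hcon ⟨by omega, k, h1, h2, h⟩
    obtain ⟨v, hv, hv0⟩ := Matrix.exists_mulVec_eq_zero_iff.2 hdet
    have hmul := sum_smul_of_mul_weightedSum q v
    simp only [hv0, Pi.zero_apply, zero_smul, sum_const_zero] at hmul
    refine hv (eq_zero_of_sum_smul_of_eq_zero
      (eq_zero_of_mul_weightedSum_eq_zero hq le_rfl ?_))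
    simpa using hmul
  · rintro ⟨_, k, hk1, hk2, h⟩
    have hk0 : (k : ℂ) ≠ 0 := Nat.cast_ne_zero.2 (by omega)
    rcases h with rfl | h
    · refine Omega_det_eq_zero_of_character (c := -1) (k := k)
        (((Int.castRingHom ℂ).toMonoidHom.comp (Units.coeHom ℤ)).comp Perm.sign)
        (fun i j hij => by simp [sign_swap hij]) (by omega) ?_
      field_simp
      ring
    · refine Omega_det_eq_zero_of_character (c := 1) (k := k) 1 (fun _ _ _ => rfl) (by omega) ?_
      rw [← neg_neg q, h]
      field_simp
      ring
end
end
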